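/- arXiv:1910.08718 — 2 statements merged into one kernel-verified Lean document; each statement's English description precedes it below -/
import Mathlib

section
/- Let G = (V, E, w) be a finite directed weighted graph containing at least one cycle, and let μ* be the minimum mean weight over all cycles of G. Then for every path p from v₀ to v_k in G with T = ψ(p) edges, there exists a simple path p_s from v₀ to v_k in G such that w(p) ≥ μ*·(T − ψ(p_s)) + w(p_s). In particular, since p_s has at most |V| − 1 edges and there are only finitely many simple paths, w(p) ≥ μ*·T − C for a constant C independent of p. -/
/-- `p` is a path (walk) in the directed graph with edge relation `E`:
a nonempty list of vertices with consecutive vertices joined by edges. -/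
def IsWalk {V : Type*} (E : V → V → Prop) (p : List V) : Prop :=
  p ≠ [] ∧ p.Chain' E

/-- The multiset of edges of a path, counted with multiplicity. -/
def edgeMS {V : Type*} (p : List V) : Multiset (V × V) :=
  ↑(p.zip p.tail)

/-- The number of edges ψ(p) of a path. -/
def numEdges {V : Type*} (p : List V) : ℕ := p.length - 1

/-- The weight of a path: the sum of the weights of its edges. -/
def pathWeight {V : Type*} (w : V → V → ℝ) (p : List V) : ℝ :=
  ((p.zip p.tail).map (fun e => w e.1 e.2)).sum

/-- A cycle: a path with at least one edge whose first and last vertices coincide. -/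
def IsCycle {V : Type*} (E : V → V → Prop) (p : List V) : Prop :=
  IsWalk E p ∧ 2 ≤ p.length ∧ p.head? = p.getLast?

/-- A simple cycle: a cycle ⟨v₀, …, v_k, v₀⟩ whose vertices v₀, …, v_k are pairwise
distinct (i.e. no repeated vertices except first = last). -/
def IsSimpleCycle {V : Type*} (E : V → V → Prop) (p : List V) : Prop :=
  IsCycle E p ∧ p.dropLast.Nodup

/-- The mean weight w̄(c) = w(c)/ψ(c) of a cycle (or path). -/
noncomputable def meanWeight {V : Type*} (w : V → V → ℝ) (p : List V) : ℝ :=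
  pathWeight w p / (numEdges p : ℝ)


theorem pathWeight_cons_cons {V : Type*} (w : V → V → ℝ) (x y : V) (l : List V) :
    pathWeight w (x :: y :: l) = w x y + pathWeight w (y :: l) := by
  simp [pathWeight]

theorem numEdges_cons_cons {V : Type*} (x y : V) (l : List V) :
    numEdges (x :: y :: l) = numEdges (y :: l) + 1 := by
  simp [numEdges]

/-- Splitting a path at one of its vertices splits its weight. -/
theorem pathWeight_append_cons {V : Type*} (w : V → V → ℝ) (a : List V) (x : V) (b : List V) :
    pathWeight w (a ++ x :: b) = pathWeight w (a ++ [x]) + pathWeight w (x :: b) := by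
  induction a with
  | nil => simp [pathWeight]
  | cons y a ih =>
    cases a with
    | nil => simp [pathWeight]
    | cons z a =>
      simp only [List.cons_append, pathWeight_cons_cons] at ih ⊢
      rw [ih, add_assoc]

theorem numEdges_append_cons {V : Type*} (a : List V) (x : V) (b : List V) :
    numEdges (a ++ x :: b) = numEdges (a ++ [x]) + numEdges (x :: b) := by
  simp [numEdges]

theorem IsCycle.mul_numEdges_le {V : Type*} {E : V → V → Prop} {w : V → V → ℝ} {c : List V}
    {μ : ℝ} (hc : IsCycle E c) (h : μ ≤ meanWeight w c) :
    μ * numEdges c ≤ pathWeight w c := by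
  have hpos : (0 : ℝ) < numEdges c := by
    have := hc.2.1
    exact_mod_cast (show 0 < numEdges c by unfold numEdges; omega)
  exact (le_div_iff₀ hpos).1 h

/-- If every cycle weighs at least `μ` per edge, then any path can be shortcut to a simple path
with the same endpoints, where the removed edges weigh at least `μ` each on average. -/
theorem exists_nodup_walk_of_cycle_bound {V : Type*} {E : V → V → Prop} {w : V → V → ℝ} {μ : ℝ}
    (hcycle : ∀ c, IsCycle E c → μ * numEdges c ≤ pathWeight w c) {p : List V}
    (hp : IsWalk E p) :
    ∃ ps : List V, IsWalk E ps ∧ ps.Nodup ∧ ps.head? = p.head? ∧ ps.getLast? = p.getLast? ∧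
      pathWeight w p ≥ μ * ((numEdges p : ℝ) - (numEdges ps : ℝ)) + pathWeight w ps := by
  induction p with
  | nil => exact absurd rfl hp.1
  | cons x l ih =>
    cases l with
    | nil => exact ⟨[x], hp, List.nodup_singleton x, rfl, rfl, by simp⟩
    | cons y l =>
      obtain ⟨hxy, hyl⟩ := List.isChain_cons_cons.1 hp.2
      obtain ⟨qs, hqs, hnd, hh, hl, hw⟩ := ih ⟨List.cons_ne_nil _ _, hyl⟩
      obtain ⟨q, rfl⟩ : ∃ q, qs = y :: q := by
        cases qs with
        | nil => simp at hh
        | cons z q => exact ⟨q, by simp_all⟩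
      have hxqs : IsWalk E (x :: y :: q) :=
        ⟨List.cons_ne_nil _ _, List.isChain_cons_cons.2 ⟨hxy, hqs.2⟩⟩
      have hlast : (x :: y :: q).getLast? = (x :: y :: l).getLast? := by
        rw [List.getLast?_cons_cons, List.getLast?_cons_cons, hl]
      have hbound : pathWeight w (x :: y :: l) ≥
          μ * ((numEdges (x :: y :: l) : ℝ) - numEdges (x :: y :: q)) +
            pathWeight w (x :: y :: q) := by
        simp only [pathWeight_cons_cons, numEdges_cons_cons, Nat.cast_add, Nat.cast_one]
        linarith
      by_cases hx : x ∈ y :: q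
      · obtain ⟨a, b, hab⟩ := List.append_of_mem hx
        rw [hab] at hxqs hlast hbound hnd
        rw [← List.cons_append] at hxqs hlast hbound
        have hcyc : IsCycle E (x :: a ++ [x]) := by
          refine ⟨⟨by simp, hxqs.2.prefix ?_⟩, by simp, by rw [List.getLast?_concat]; rfl⟩
          exact (List.prefix_append_right_inj _).2 ⟨b, rfl⟩
        refine ⟨x :: b, ⟨by simp, hxqs.2.suffix (List.suffix_append _ _)⟩,
          hnd.sublist (List.sublist_append_right _ _), rfl, ?_, ?_⟩
        · rw [← hlast, List.getLast?_append_of_ne_nil _ (List.cons_ne_nil _ _)]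
        · have hc := hcycle _ hcyc
          rw [pathWeight_append_cons, numEdges_append_cons, Nat.cast_add] at hbound
          linarith
      · exact ⟨x :: y :: q, hxqs, List.nodup_cons.2 ⟨hx, hnd⟩, rfl, hlast, hbound⟩

/-- lower bound on path weights via the minimum cycle mean.
In a finite directed weighted graph containing at least one cycle, with `μ` the
minimum mean weight over all cycles: every path `p` from `v₀` to `v_k` with
`T = ψ(p)` edges admits a simple path `p_s` from `v₀` to `v_k` with
`w(p) ≥ μ·(T − ψ(p_s)) + w(p_s)`; in particular there is a constant `C`,
independent of the path, with `w(p) ≥ μ·ψ(p) − C` for every path `p`. -/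
theorem stmt7 {V : Type*} [Fintype V] (E : V → V → Prop) (w : V → V → ℝ)
    (hcyc : ∃ c : List V, IsCycle E c)
    (μ : ℝ) (hμ : IsLeast {m : ℝ | ∃ c, IsCycle E c ∧ m = meanWeight w c} μ) :
    (∀ (p : List V) (v0 vk : V), IsWalk E p → p.head? = some v0 →
      p.getLast? = some vk →
      ∃ ps : List V, IsWalk E ps ∧ ps.Nodup ∧ ps.head? = some v0 ∧
        ps.getLast? = some vk ∧
        pathWeight w p ≥ μ * ((numEdges p : ℝ) - (numEdges ps : ℝ)) + pathWeight w ps) ∧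
    ∃ C : ℝ, ∀ p : List V, IsWalk E p →
      pathWeight w p ≥ μ * (numEdges p : ℝ) - C := by
  have hcycle : ∀ c, IsCycle E c → μ * numEdges c ≤ pathWeight w c := fun c hc =>
    hc.mul_numEdges_le (hμ.2 ⟨c, hc, rfl⟩)
  have hsimple := fun p hp => exists_nodup_walk_of_cycle_bound (w := w) hcycle (p := p) hp
  refine ⟨fun p v0 vk hp hv0 hvk => ?_, ?_⟩
  · obtain ⟨ps, hps, hnd, hh, hl, hw⟩ := hsimple p hp
    exact ⟨ps, hps, hnd, hh.trans hv0, hl.trans hvk, hw⟩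
  · classical
    obtain ⟨B, hB⟩ := (Set.finite_range fun l : {l : List V // l.Nodup} =>
      pathWeight w l.1 - μ * numEdges l.1).bddBelow
    refine ⟨-B, fun p hp => ?_⟩
    obtain ⟨ps, -, hnd, -, -, hw⟩ := hsimple p hp
    have hps : B ≤ pathWeight w ps - μ * numEdges ps := hB ⟨⟨ps, hnd⟩, rfl⟩
    linarith
end

section
/- Consider a finite deterministic controlled system with state set X, action set A, nonempty admissible-action sets A(x), transition map f, and stage cost g, and let μ* be the minimum mean weight over all cycles of the OSTG from an initial state x₀ ∈ X. Then the optimal average cost from x₀ is achieved by a static state-feedback law: there exists a map κ : X → A with κ(x) ∈ A(x) for all x ∈ X such that the closed-loop trajectory x(0) = x₀, x(t+1) = f(x(t), κ(x(t))) satisfies lim_{T → ∞} (1/T) Σ_{t=0}^{T−1} g(x(t), κ(x(t))) = μ*; moreover, this closed-loop trajectory converges in finitely many steps to a simple cycle of the OSTG whose mean weight is μ*. -/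
/-- `Reach Adm f x0 x`: the state `x` is reachable from `x0` by an admissible
trajectory of the controlled system with admissible-action sets `Adm` and
transition map `f`. -/
def Reach {X A : Type*} (Adm : X → Set A) (f : X → A → X) (x0 x : X) : Prop :=
  ∃ (k : ℕ) (y : ℕ → X) (b : ℕ → A), y 0 = x0 ∧ y k = x ∧
    ∀ t < k, b t ∈ Adm (y t) ∧ y (t + 1) = f (y t) (b t)

/-- The edge relation of the optimal state transition graph (OSTG) from `x0`:
there is an edge `(x, y)` iff `x` is reachable from `x0` and some admissible
action at `x` steers the system to `y`. -/
def OEdge {X A : Type*} (Adm : X → Set A) (f : X → A → X) (x0 : X)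
    (x y : X) : Prop :=
  Reach Adm f x0 x ∧ ∃ a ∈ Adm x, f x a = y

/-- The edge weight of the OSTG:
`w(x, y) = min { g(x, a) : a ∈ Adm x, f x a = y }`. -/
noncomputable def OWeight {X A : Type*} (Adm : X → Set A) (f : X → A → X)
    (g : X → A → ℝ) (x y : X) : ℝ :=
  sInf {r : ℝ | ∃ a ∈ Adm x, f x a = y ∧ r = g x a}

lemma pathWeight_map_range {V : Type*} (w : V → V → ℝ) (n : ℕ) (q : ℕ → V) :
    pathWeight w ((List.range (n + 1)).map q) = ∑ t ∈ Finset.range n, w (q t) (q (t + 1)) := by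
  induction n generalizing q with
  | zero => simp [pathWeight]
  | succ n ih =>
    have h := ih (fun t => q (t + 1))
    rw [Finset.sum_range_succ', ← h, List.range_succ_eq_map, List.range_succ_eq_map]
    simp [pathWeight, Function.comp_def, add_comm]

lemma meanWeight_map_range {V : Type*} (w : V → V → ℝ) (n : ℕ) (q : ℕ → V) :
    meanWeight w ((List.range (n + 1)).map q) =
      (∑ t ∈ Finset.range n, w (q t) (q (t + 1))) / (n : ℝ) := by
  simp [meanWeight, pathWeight_map_range, numEdges]

lemma isCycle_map_range_iff {V : Type*} (E : V → V → Prop) (n : ℕ) (q : ℕ → V) :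
    IsCycle E ((List.range (n + 1)).map q) ↔
      1 ≤ n ∧ q n = q 0 ∧ ∀ t < n, E (q t) (q (t + 1)) := by
  have h1 : ((List.range (n + 1)).map q).Chain' E ↔ ∀ t < n, E (q t) (q (t + 1)) := by
    change ((List.range (n + 1)).map q).IsChain E ↔ _
    simp [List.isChain_iff_getElem]
  have h2 : ((List.range (n + 1)).map q).head? = some (q 0) := by
    simp [List.range_succ_eq_map]
  have h3 : ((List.range (n + 1)).map q).getLast? = some (q n) := by
    simp [List.range_succ]
  have h4 : (List.range (n + 1)).map q ≠ [] := by simp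
  rw [IsCycle, IsWalk, h1, h2, h3]
  simp only [List.length_map, List.length_range, Option.some.injEq]
  constructor
  · rintro ⟨⟨-, h⟩, h', h''⟩
    exact ⟨by omega, h''.symm, h⟩
  · rintro ⟨h', h'', h⟩
    exact ⟨⟨h4, h⟩, by omega, h''.symm⟩

lemma sum_window_of_periodic {c : ℕ → ℝ} {L : ℕ} (hc : ∀ t, c (t + L) = c t) (i : ℕ) :
    ∑ t ∈ Finset.range L, c (i + t) = ∑ t ∈ Finset.range L, c t := by
  induction i with
  | zero => simp
  | succ i ih =>
    rw [← ih]
    have h1 := Finset.sum_range_succ (fun t => c (i + t)) L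
    have h2 := Finset.sum_range_succ' (fun t => c (i + t)) L
    have h3 : ∀ t, c (i + 1 + t) = c (i + (t + 1)) := fun t => by congr 1; omega
    simp only [h3]
    have := hc i
    simp only [add_zero] at h2
    linarith

/-- A sequence that is eventually periodic with average `μ` over a period has Cesàro limit `μ`. -/
lemma tendsto_average_of_eventually_periodic {c : ℕ → ℝ} {T0 L : ℕ} {μ : ℝ} (hL : 1 ≤ L)
    (hc : ∀ t, c (T0 + (t + L)) = c (T0 + t))
    (hμ : ∑ t ∈ Finset.range L, c (T0 + t) = μ * L) :
    Filter.Tendsto (fun T : ℕ => (∑ t ∈ Finset.range T, c t) / (T : ℝ))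
      Filter.atTop (nhds μ) := by
  set F : ℕ → ℝ := fun T => (∑ t ∈ Finset.range T, c t) - μ * T with hF
  have hper : ∀ T, T0 ≤ T → F (T + L) = F T := by
    intro T hT
    obtain ⟨k, rfl⟩ := Nat.exists_eq_add_of_le hT
    have h := sum_window_of_periodic (c := fun t => c (T0 + t)) hc k
    simp only [hF, Finset.sum_range_add]
    simp only [← add_assoc] at h
    push_cast
    linarith
  have hbd : ∀ T, |F T| ≤ ∑ i ∈ Finset.range (T0 + L), |F i| := by
    intro T
    induction T using Nat.strong_induction_on with
    | _ T ih =>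
      by_cases h : T < T0 + L
      · exact Finset.single_le_sum (f := fun i => |F i|) (fun i _ => abs_nonneg _)
          (Finset.mem_range.2 h)
      · have h1 := hper (T - L) (by omega)
        rw [Nat.sub_add_cancel (by omega)] at h1
        rw [h1]
        exact ih _ (by omega)
  have h0 : Filter.Tendsto (fun T : ℕ => F T / (T : ℝ)) Filter.atTop (nhds 0) := by
    refine squeeze_zero_norm (a := fun T : ℕ => (∑ i ∈ Finset.range (T0 + L), |F i|) / (T : ℝ))
      (fun T => ?_) (tendsto_const_div_atTop_nhds_zero_nat _)
    rw [norm_div, Real.norm_eq_abs, Real.norm_natCast]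
    gcongr
    exact hbd T
  have h1 := h0.add_const μ
  rw [zero_add] at h1
  refine h1.congr' ?_
  filter_upwards [Filter.eventually_ge_atTop 1] with T hT
  have : (T : ℝ) ≠ 0 := by positivity
  simp only [hF]
  field_simp
  ring

/-- If the minimum mean weight over all cycles is `μ`, it is attained along a periodic vertex
sequence that visits pairwise distinct vertices within a period. -/
lemma exists_periodic_simple_of_isLeast {V : Type*} {E : V → V → Prop} {w : V → V → ℝ} {μ : ℝ}
    (hμ : IsLeast {m : ℝ | ∃ c : List V, IsCycle E c ∧ m = meanWeight w c} μ) :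
    ∃ (p : ℕ → V) (d : ℕ), 1 ≤ d ∧ (∀ s t, p s = p t ↔ s ≡ t [MOD d]) ∧
      (∀ t, E (p t) (p (t + 1))) ∧
      ∑ t ∈ Finset.range d, w (p t) (p (t + 1)) = μ * d := by
  classical
  obtain ⟨⟨c, hc, hcμ⟩, hmin⟩ := hμ
  obtain ⟨L, hL⟩ : ∃ L, c.length = L + 1 := ⟨c.length - 1, by have := hc.2.1; omega⟩
  have hcq : ∃ q : ℕ → V, c = (List.range (L + 1)).map q := by
    have hne := hc.1.1
    refine ⟨fun i => c.getD i (c.head hne), List.ext_getElem (by simp [hL]) fun i h1 h2 => ?_⟩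
    simp [h1]
  obtain ⟨q, rfl⟩ := hcq
  rw [isCycle_map_range_iff] at hc
  obtain ⟨hL1, hq, hqE⟩ := hc
  rw [meanWeight_map_range] at hcμ
  have hLpos : (0 : ℝ) < L := by exact_mod_cast hL1
  set y : ℕ → V := fun t => q (t % L) with hy
  have hyper : ∀ t, y (t + L) = y t := fun t => by simp [hy]
  have hysucc : ∀ t, y (t + 1) = q (t % L + 1) := by
    intro t
    have hlt := Nat.mod_lt t hL1
    by_cases h : t % L + 1 = L
    · have : (t + 1) % L = 0 := by rw [← Nat.mod_add_mod, h, Nat.mod_self]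
      simp only [hy, this, hq, h]
    · have : (t + 1) % L = t % L + 1 := by
        rw [← Nat.mod_add_mod, Nat.mod_eq_of_lt (by omega)]
      simp only [hy, this]
  have hyE : ∀ t, E (y t) (y (t + 1)) := by
    intro t
    rw [hysucc]
    exact hqE _ (Nat.mod_lt t hL1)
  have hwper : ∀ t, w (y (t + L)) (y (t + L + 1)) = w (y t) (y (t + 1)) := by
    intro t
    rw [hyper, show t + L + 1 = t + 1 + L by omega, hyper]
  have hsum : ∑ t ∈ Finset.range L, w (y t) (y (t + 1)) = μ * L := by
    rw [hcμ, div_mul_cancel₀ _ hLpos.ne']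
    refine Finset.sum_congr rfl fun t ht => ?_
    have : t % L = t := Nat.mod_eq_of_lt (Finset.mem_range.1 ht)
    rw [hysucc, this]
    simp only [hy, this]
  have hlow : ∀ a d, y (a + d) = y a →
      μ * d ≤ ∑ t ∈ Finset.range d, w (y (a + t)) (y (a + t + 1)) := by
    intro a d had
    rcases Nat.eq_zero_or_pos d with rfl | hd
    · simp
    have h := hmin ⟨_, (isCycle_map_range_iff E d (fun t => y (a + t))).2
      ⟨hd, had, fun t _ => hyE _⟩, rfl⟩
    rw [meanWeight_map_range, le_div_iff₀ (by exact_mod_cast hd)] at h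
    exact h
  have hex : ∃ d, 1 ≤ d ∧ ∃ a, y (a + d) = y a := ⟨L, hL1, 0, hyper 0⟩
  obtain ⟨hd1, a, had⟩ := Nat.find_spec hex
  have hdL : Nat.find hex ≤ L := Nat.find_min' hex ⟨hL1, 0, hyper 0⟩
  have hdmin : ∀ e, 1 ≤ e → ∀ b, y (b + e) = y b → Nat.find hex ≤ e :=
    fun e he b hb => Nat.find_min' hex ⟨he, b, hb⟩
  generalize Nat.find hex = d at hd1 had hdL hdmin
  have htight : ∑ t ∈ Finset.range d, w (y (a + t)) (y (a + t + 1)) = μ * d := by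
    refine le_antisymm ?_ (hlow a d had)
    have h1 := hlow (a + d) (L - d) (by
      rw [show a + d + (L - d) = a + L by omega, hyper, had])
    have h2 := sum_window_of_periodic (c := fun t => w (y t) (y (t + 1))) hwper a
    rw [hsum] at h2
    conv_lhs at h2 => rw [show L = d + (L - d) by omega]
    rw [Finset.sum_range_add] at h2
    simp only [← add_assoc] at h2
    rw [Nat.cast_sub hdL] at h1
    linarith
  have hpsucc : ∀ t, y (a + (t + 1) % d) = y (a + t % d + 1) := by
    intro t
    have hlt := Nat.mod_lt t hd1
    by_cases h : t % d + 1 = d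
    · have : (t + 1) % d = 0 := by rw [← Nat.mod_add_mod, h, Nat.mod_self]
      rw [this, add_assoc, h, had, add_zero]
    · have : (t + 1) % d = t % d + 1 := by
        rw [← Nat.mod_add_mod, Nat.mod_eq_of_lt (by omega)]
      rw [this, add_assoc]
  have hinj : ∀ i j, i < j → j < d → y (a + i) ≠ y (a + j) := by
    intro i j hij hjd h
    have := hdmin (j - i) (by omega) (a + i) (by
      rw [show a + i + (j - i) = a + j by omega, h])
    omega
  refine ⟨fun t => y (a + t % d), d, hd1, fun s t => ⟨fun h => ?_, fun h => ?_⟩, fun t => ?_, ?_⟩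
  · have hs := Nat.mod_lt s hd1
    have ht := Nat.mod_lt t hd1
    rcases lt_trichotomy (s % d) (t % d) with hlt | heq | hlt
    · exact absurd h (hinj _ _ hlt ht)
    · exact heq
    · exact absurd h.symm (hinj _ _ hlt hs)
  · exact congrArg (fun i => y (a + i)) h
  · simp only [hpsucc]
    exact hyE _
  · rw [← htight]
    refine Finset.sum_congr rfl fun t ht => ?_
    simp only [hpsucc]
    rw [Nat.mod_eq_of_lt (Finset.mem_range.1 ht)]

/-- `StepsTo Adm f C n x`: some admissible trajectory leads from `x` into `C` in `n` steps. -/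
def StepsTo {X A : Type*} (Adm : X → Set A) (f : X → A → X) (C : Set X) : ℕ → X → Prop
  | 0, x => x ∈ C
  | n + 1, x => ∃ a ∈ Adm x, StepsTo Adm f C n (f x a)

lemma Reach.exists_stepsTo {X A : Type*} {Adm : X → Set A} {f : X → A → X} {C : Set X}
    {x0 x : X} (h : Reach Adm f x0 x) (hx : x ∈ C) : ∃ n, StepsTo Adm f C n x0 := by
  obtain ⟨k, y, b, h0, hk, hstep⟩ := h
  have key : ∀ n ≤ k, StepsTo Adm f C n (y (k - n)) := by
    intro n
    induction n with
    | zero => intro _; simpa [StepsTo, hk] using hx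
    | succ n ih =>
      intro hn
      obtain ⟨hb, hy⟩ := hstep (k - (n + 1)) (by omega)
      refine ⟨_, hb, ?_⟩
      rw [← hy, show k - (n + 1) + 1 = k - n by omega]
      exact ih (by omega)
  exact ⟨k, by simpa [h0] using key k le_rfl⟩

lemma exists_action_eq_oWeight {X A : Type*} [Finite A] {Adm : X → Set A} {f : X → A → X}
    (g : X → A → ℝ) {x y : X} (h : ∃ a ∈ Adm x, f x a = y) :
    ∃ a ∈ Adm x, f x a = y ∧ g x a = OWeight Adm f g x y := by
  have hfin : {r : ℝ | ∃ a ∈ Adm x, f x a = y ∧ r = g x a}.Finite :=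
    (Set.finite_range (g x)).subset (by rintro r ⟨a, -, -, rfl⟩; exact ⟨a, rfl⟩)
  obtain ⟨a, ha, hfa⟩ := h
  have hne : {r : ℝ | ∃ a ∈ Adm x, f x a = y ∧ r = g x a}.Nonempty := ⟨g x a, a, ha, hfa, rfl⟩
  obtain ⟨b, hb, hfb, hgb⟩ := hne.csInf_mem hfin
  exact ⟨b, hb, hfb, hgb.symm⟩

/-- Theorem 2: static state feedback achieves the optimal
average cost. Let `μ` be the minimum mean cycle weight of the OSTG from `x₀`.
Then there is a static state-feedback law `κ : X → A` with `κ x ∈ A(x)` for all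
`x` such that the closed-loop trajectory `x(0) = x₀`, `x(t+1) = f(x(t), κ(x(t)))`
has long-run average cost converging to `μ`, and converges in finitely many
steps to a simple cycle of the OSTG whose mean weight is `μ`. -/
theorem stmt15 {X A : Type*} [Fintype X] [Fintype A]
    (Adm : X → Set A) (hAdm : ∀ x : X, (Adm x).Nonempty)
    (f : X → A → X) (g : X → A → ℝ) (x0 : X)
    (μ : ℝ)
    (hμ : IsLeast {m : ℝ | ∃ c : List X, IsCycle (OEdge Adm f x0) c ∧
      m = meanWeight (OWeight Adm f g) c} μ) :
    ∃ κ : X → A, (∀ x : X, κ x ∈ Adm x) ∧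
      ∀ x : ℕ → X, x 0 = x0 → (∀ t : ℕ, x (t + 1) = f (x t) (κ (x t))) →
        Filter.Tendsto
          (fun T : ℕ => (∑ t ∈ Finset.range T, g (x t) (κ (x t))) / (T : ℝ))
          Filter.atTop (nhds μ) ∧
        ∃ T0 L : ℕ, 1 ≤ L ∧ (∀ t : ℕ, T0 ≤ t → x (t + L) = x t) ∧
          IsSimpleCycle (OEdge Adm f x0)
            ((List.range (L + 1)).map (fun s => x (T0 + s))) ∧
          meanWeight (OWeight Adm f g)
            ((List.range (L + 1)).map (fun s => x (T0 + s))) = μ := by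
  obtain ⟨p, d, hd, hp, hpE, hpsum⟩ := exists_periodic_simple_of_isLeast hμ
  have hκ : ∀ x : X, ∃ a ∈ Adm x,
      (∀ s, x = p s → f x a = p (s + 1) ∧ g x a = OWeight Adm f g (p s) (p (s + 1))) ∧
      ∀ n, StepsTo Adm f (Set.range p) (n + 1) x →
        (∀ m ≤ n, ¬ StepsTo Adm f (Set.range p) m x) →
        StepsTo Adm f (Set.range p) n (f x a) := by
    intro x
    by_cases hx : x ∈ Set.range p
    · obtain ⟨s, rfl⟩ := hx
      obtain ⟨a, ha, hfa, hga⟩ := exists_action_eq_oWeight g (hpE s).2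
      refine ⟨a, ha, fun t hst => ?_, fun n _ hn => absurd ⟨s, rfl⟩ (hn 0 n.zero_le)⟩
      have hst' : p (s + 1) = p (t + 1) := (hp _ _).2 (((hp _ _).1 hst).add_right 1)
      rw [← hst, ← hst']
      exact ⟨hfa, hga⟩
    · by_cases hn : ∃ n, StepsTo Adm f (Set.range p) (n + 1) x ∧
        ∀ m ≤ n, ¬ StepsTo Adm f (Set.range p) m x
      · obtain ⟨n, ⟨a, ha, hna⟩, hmin⟩ := hn
        refine ⟨a, ha, fun s hs => absurd ⟨s, hs.symm⟩ hx, fun k hk hkmin => ?_⟩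
        have h1 : ¬ k + 1 ≤ n := fun h => hmin _ h hk
        have h2 : ¬ n + 1 ≤ k := fun h => hkmin _ h ⟨a, ha, hna⟩
        obtain rfl : k = n := by omega
        exact hna
      · obtain ⟨a, ha⟩ := hAdm x
        exact ⟨a, ha, fun s hs => absurd ⟨s, hs.symm⟩ hx,
          fun k hk hkmin => absurd ⟨k, hk, hkmin⟩ hn⟩
  choose κ hκAdm hκp hκn using hκ
  refine ⟨κ, hκAdm, fun x hx0 hx => ?_⟩
  have hhit : ∀ n t, StepsTo Adm f (Set.range p) n (x t) → ∃ T, x T ∈ Set.range p := by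
    intro n
    induction n using Nat.strong_induction_on with
    | _ n ih =>
      intro t ht
      by_cases hm : ∃ m < n, StepsTo Adm f (Set.range p) m (x t)
      · obtain ⟨m, hmn, hm⟩ := hm
        exact ih m hmn t hm
      · cases n with
        | zero => exact ⟨t, ht⟩
        | succ n =>
          refine ih n n.lt_succ_self (t + 1) ?_
          rw [hx]
          exact hκn _ _ ht fun m hmn h => hm ⟨m, by omega, h⟩
  obtain ⟨n, hn⟩ := (hpE 0).1.exists_stepsTo (C := Set.range p) ⟨0, rfl⟩
  obtain ⟨T0, s, hs⟩ := hhit n 0 (by rwa [hx0])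
  have hxp : ∀ t, x (T0 + t) = p (s + t) := by
    intro t
    induction t with
    | zero => exact hs.symm
    | succ t ih => rw [← add_assoc, hx, (hκp _ _ ih).1, add_assoc]
  have hper : ∀ t, p (t + d) = p t := fun t => (hp _ _).2 (by simp [Nat.ModEq])
  have hsum : ∑ t ∈ Finset.range d, OWeight Adm f g (p (s + t)) (p (s + t + 1)) = μ * d := by
    rw [← hpsum]
    refine sum_window_of_periodic (c := fun t => OWeight Adm f g (p t) (p (t + 1))) (fun t => ?_) s
    rw [hper, show t + d + 1 = t + 1 + d by omega, hper]
  have hxper : ∀ t, x (T0 + (t + d)) = x (T0 + t) := fun t => by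
    rw [hxp, hxp, ← add_assoc, hper]
  refine ⟨tendsto_average_of_eventually_periodic (T0 := T0) hd (fun t => ?_) ?_, T0, d, hd,
    fun t ht => ?_, ⟨?_, ?_⟩, ?_⟩
  · rw [hxper]
  · rw [← hsum]
    exact Finset.sum_congr rfl fun t _ => (hκp _ _ (hxp t)).2
  · obtain ⟨k, rfl⟩ := Nat.exists_eq_add_of_le ht
    rw [add_assoc, hxper]
  · simp only [hxp]
    rw [isCycle_map_range_iff]
    exact ⟨hd, hper s, fun t _ => hpE _⟩
  · simp only [hxp]
    rw [List.range_succ, List.map_append, List.map_singleton, List.dropLast_concat]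
    refine List.Nodup.map_on (fun i hi j hj hij => ?_) List.nodup_range
    exact (((hp _ _).1 hij).add_left_cancel' s).eq_of_lt_of_lt
      (List.mem_range.1 hi) (List.mem_range.1 hj)
  · simp only [hxp]
    rw [meanWeight_map_range, eq_comm, eq_div_iff (by positivity), ← hsum]
    rfl
end
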